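/- arXiv:1306.0747 — 2 statements merged into one kernel-verified Lean document; each statement's English description precedes it below -/
import Mathlib

section
/- Let G be a finite group and π a non-empty set of primes. Then d_π(G) = 1 if and only if G has a normal π-complement and an abelian Hall π-subgroup. -/
open scoped Classical Pointwise

/-- A `π`-element: every prime divisor of its order lies in `π`. -/
def IsPiElement {G : Type*} [Group G] (π : Set ℕ) (x : G) : Prop :=
  ∀ q : ℕ, q.Prime → q ∣ orderOf x → q ∈ π

/-- `kPi π G` is the number of conjugacy classes of `π`-elements of `G`. -/
noncomputable def kPi (π : Set ℕ) (G : Type*) [Group G] : ℕ :=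
  Nat.card {c : ConjClasses G | ∃ x : G, ConjClasses.mk x = c ∧ IsPiElement π x}

/-- The `π`-part of a natural number: the largest divisor all of whose prime
divisors lie in `π`. -/
noncomputable def piPart (π : Set ℕ) (n : ℕ) : ℕ :=
  n.factorization.prod fun p k => if p ∈ π then p ^ k else 1

/-- `dPi π G = kPi π G / |G|_π`. -/
noncomputable def dPi (π : Set ℕ) (G : Type*) [Group G] : ℚ :=
  (kPi π G : ℚ) / (piPart π (Nat.card G) : ℚ)

theorem crt_split (p n : ℕ) (hp : p.Prime) (hn : n ≠ 0) :
    ∃ k l a m : ℕ, p ^ a * m = n ∧ ¬ p ∣ m ∧ p ^ a ∣ l ∧ m ∣ k ∧ k + l ≡ 1 [MOD n] := by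
  obtain ⟨a, m, hm, rfl⟩ := Nat.exists_eq_pow_mul_and_not_dvd hn p hp.ne_one
  have hc : Nat.Coprime (p ^ a) m := Nat.Coprime.pow_left _ ((Nat.Prime.coprime_iff_not_dvd hp).2 hm)
  obtain ⟨k, hk1, hk2⟩ := Nat.chineseRemainder hc 1 0
  obtain ⟨l, hl1, hl2⟩ := Nat.chineseRemainder hc 0 1
  refine ⟨k, l, a, m, rfl, hm, (Nat.modEq_zero_iff_dvd).1 hl1, (Nat.modEq_zero_iff_dvd).1 hk2, ?_⟩
  rw [← Nat.modEq_and_modEq_iff_modEq_mul hc]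
  exact ⟨by simpa using hk1.add hl1, by simpa using hk2.add hl2⟩

theorem split_elem {G : Type*} [Group G] (x : G) {k l a m p : ℕ}
    (hx : p ^ a * m = orderOf x) (hl : p ^ a ∣ l) (hk : m ∣ k) (h : k + l ≡ 1 [MOD orderOf x]) :
    x ^ k * x ^ l = x ∧ (x ^ k) ^ (p ^ a) = 1 ∧ (x ^ l) ^ m = 1 := by
  refine ⟨?_, ?_, ?_⟩
  · rw [← pow_add]
    conv_rhs => rw [← pow_one x]
    exact pow_eq_pow_iff_modEq.2 h
  · rw [← pow_mul]
    apply orderOf_dvd_iff_pow_eq_one.1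
    rw [← hx, mul_comm]
    exact Nat.mul_dvd_mul hk dvd_rfl
  · rw [← pow_mul]
    apply orderOf_dvd_iff_pow_eq_one.1
    rw [← hx]
    exact Nat.mul_dvd_mul hl dvd_rfl

theorem conj_of_p {G : Type*} [Group G] [Finite G] (N : Subgroup G) [N.Normal] {p a : ℕ}
    (hp : p.Prime) (hN : ¬ p ∣ Nat.card N) (x y : G) (hx : x ^ p ^ a = 1) (hy : y ^ p ^ a = 1)
    (hxy : (x : G ⧸ N) = y) : ∃ g ∈ N, x * g * y⁻¹ = g := by
  have key : ∀ x y : G, (x : G ⧸ N) = y → ∀ n : N, x * n * y⁻¹ ∈ N := by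
    intro x y hxy n
    rw [← QuotientGroup.eq_one_iff]
    simp [hxy]
  have hxy' : ((x⁻¹ : G) : G ⧸ N) = (y⁻¹ : G) := by simp [hxy]
  let σ : Equiv.Perm N :=
    { toFun := fun n => ⟨x * n * y⁻¹, key x y hxy n⟩
      invFun := fun n => ⟨x⁻¹ * n * (y⁻¹)⁻¹, key _ _ hxy' n⟩
      left_inv := fun n => by ext; simp [mul_assoc]
      right_inv := fun n => by ext; simp [mul_assoc] }
  have hσ : ∀ k : ℕ, ∀ n : N, (((σ ^ k) n : N) : G) = x ^ k * n * (y ^ k)⁻¹ := by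
    intro k
    induction k with
    | zero => simp
    | succ k ih =>
      intro n
      rw [pow_succ', Equiv.Perm.mul_apply]
      change x * (((σ ^ k) n : N) : G) * y⁻¹ = _
      rw [ih, pow_succ' x, pow_succ' y]
      group
  have : Fact p.Prime := ⟨hp⟩
  have := Fintype.ofFinite N
  obtain ⟨g, hg⟩ := Equiv.Perm.exists_fixed_point_of_prime (p := p) (n := a) (σ := σ)
    (by rwa [Nat.card_eq_fintype_card] at hN) (by ext n; rw [hσ]; simp [hx, hy])
  exact ⟨g, g.2, congrArg Subtype.val hg⟩

theorem orderOf_eq_of_coset {G : Type*} [Group G] [Finite G] (N : Subgroup G) [N.Normal]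
    (x y : G) (hx : (orderOf x).Coprime (Nat.card N)) 
    (hxy : (x : G ⧸ N) = y) : orderOf x ∣ orderOf y := by
  apply orderOf_dvd_of_pow_eq_one
  have h1 : x ^ orderOf y ∈ N := by
    rw [← QuotientGroup.eq_one_iff, QuotientGroup.mk_pow, hxy, ← QuotientGroup.mk_pow,
      pow_orderOf_eq_one]; rfl
  have h2 : orderOf (x ^ orderOf y) ∣ Nat.card N := by
    have := orderOf_dvd_natCard (⟨_, h1⟩ : N)
    rwa [Subgroup.orderOf_mk] at this
  have h3 : orderOf (x ^ orderOf y) ∣ orderOf x := orderOf_pow_dvd _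
  exact orderOf_eq_one_iff.1 (Nat.eq_one_of_dvd_coprimes hx h3 h2)

theorem conj_of_coset.{u} (n : ℕ) : ∀ {G : Type u} [Group G] [Finite G] (N : Subgroup G) [N.Normal]
    (x y : G) (_ : (orderOf x).Coprime (Nat.card N)) (_ : (orderOf y).Coprime (Nat.card N))
    (_ : (x : G ⧸ N) = y), orderOf x = n → IsConj x y := by
  induction n using Nat.strong_induction_on with
  | _ n ih =>
  intro G _ _ N _ x y hx hy hxy hn
  have hord : orderOf x = orderOf y := Nat.dvd_antisymm (orderOf_eq_of_coset N x y hx hxy)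
    (orderOf_eq_of_coset N y x hy hxy.symm)
  by_cases h1 : n = 1
  · have hx1 : x = 1 := orderOf_eq_one_iff.1 (hn.trans h1)
    have hy1 : y = 1 := orderOf_eq_one_iff.1 (hord ▸ hn.trans h1)
    rw [hx1, hy1]
  obtain ⟨p, hp, hpn⟩ := Nat.exists_prime_and_dvd h1
  have hn0 : n ≠ 0 := hn ▸ (orderOf_pos x).ne'
  have hpN : ¬ p ∣ Nat.card N := fun h => hp.ne_one
    (Nat.eq_one_of_dvd_coprimes hx (hn ▸ hpn) h)
  obtain ⟨k, l, a, m, hpm, hm, hl, hk, hkl⟩ := crt_split p n hp hn0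
  obtain ⟨hxs, hxp, hxm⟩ := split_elem x (hn ▸ hpm) hl hk (hn ▸ hkl)
  obtain ⟨g, hgN, hg⟩ := conj_of_p N (a := a) hp hpN (x ^ k) (y ^ k) hxp
    (split_elem y (hord ▸ hn ▸ hpm) hl hk (hord ▸ hn ▸ hkl)).2.1 (by simp [hxy])
  -- replace `y`
  obtain ⟨z, hz⟩ : ∃ z, z = g * y * g⁻¹ := ⟨_, rfl⟩
  have hyz : IsConj y z := isConj_iff.2 ⟨g, hz.symm⟩
  have hzord : orderOf z = orderOf y := by
    rw [hz]
    exact orderOf_injective (MulAut.conj g).toMonoidHom (MulAut.conj g).injective y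
  have hxz : (x : G ⧸ N) = z := by
    have := (QuotientGroup.eq_one_iff g).2 hgN
    simp [hz, this, hxy]
  obtain ⟨hzs, hzp, hzm⟩ := split_elem z (hzord ▸ hord ▸ hn ▸ hpm) hl hk (hzord ▸ hord ▸ hn ▸ hkl)
  have hxzk : z ^ k = x ^ k := by
    rw [hz, conj_pow]
    rw [mul_inv_eq_iff_eq_mul] at hg ⊢
    exact hg.symm
  refine IsConj.trans ?_ hyz.symm
  let C := Subgroup.centralizer {x ^ k}
  have hxC : x ^ l ∈ C := by
    rw [Subgroup.mem_centralizer_singleton_iff]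
    exact ((Commute.refl x).pow_pow l k).eq
  have hzC : z ^ l ∈ C := by
    rw [Subgroup.mem_centralizer_singleton_iff, ← hxzk]
    exact ((Commute.refl z).pow_pow l k).eq
  have hcard : Nat.card (N.subgroupOf C) ∣ Nat.card N := by
    rw [← Subgroup.card_map_of_injective (K := N.subgroupOf C) C.subtype_injective]
    apply Subgroup.card_dvd_of_le
    rw [Subgroup.subgroupOf_map_subtype]
    exact inf_le_left
  have hlt : orderOf (⟨x ^ l, hxC⟩ : C) < n := by
    rw [Subgroup.orderOf_mk]
    have hm0 : 0 < m := Nat.pos_of_ne_zero (by rintro rfl; simp at hm)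
    refine lt_of_le_of_lt (Nat.le_of_dvd hm0 (orderOf_dvd_of_pow_eq_one hxm)) ?_
    have : m ≠ n := by rintro rfl; exact hm hpn
    exact lt_of_le_of_ne (Nat.le_of_dvd (Nat.pos_of_ne_zero hn0) ⟨p ^ a, by rw [← hpm, mul_comm]⟩) this
  have hconj : IsConj (⟨x ^ l, hxC⟩ : C) ⟨z ^ l, hzC⟩ := by
    refine ih _ hlt (N.subgroupOf C) _ _ ?_ ?_ ?_ rfl
    · rw [Subgroup.orderOf_mk]
      exact (hx.coprime_dvd_left (orderOf_pow_dvd l)).coprime_dvd_right hcard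
    · rw [Subgroup.orderOf_mk]
      exact ((hzord.symm ▸ hy : (orderOf z).Coprime _).coprime_dvd_left
        (orderOf_pow_dvd l)).coprime_dvd_right hcard
    · rw [QuotientGroup.eq, Subgroup.mem_subgroupOf]
      change (x ^ l)⁻¹ * z ^ l ∈ N
      rw [← QuotientGroup.eq]
      simp [hxz]
  obtain ⟨c, hc⟩ := isConj_iff.1 hconj
  have hc' : (c : G) * x ^ l * (c : G)⁻¹ = z ^ l := congrArg Subtype.val hc
  have hcc : (c : G) * x ^ k * (c : G)⁻¹ = x ^ k := by
    rw [(Subgroup.mem_centralizer_singleton_iff.1 c.2)]; simp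
  refine isConj_iff.2 ⟨c, ?_⟩
  calc (c : G) * x * (c : G)⁻¹ = c * (x ^ k * x ^ l) * (c : G)⁻¹ := by rw [hxs]
    _ = (c * x ^ k * (c : G)⁻¹) * (c * x ^ l * (c : G)⁻¹) := by group
    _ = z := by rw [hcc, hc', ← hxzk, hzs]

theorem piPart_finset (s : Finset ℕ) (n : ℕ) :
    piPart (s : Set ℕ) n = ∏ p ∈ s, p ^ n.factorization p := by
  unfold piPart Finsupp.prod
  simp only [Finset.mem_coe]
  rw [← Finset.prod_filter]
  apply Finset.prod_subset_one_on_sdiff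
  · intro x hx; exact (Finset.mem_filter.1 hx).2
  · intro x hx
    simp only [Finset.mem_sdiff, Finset.mem_filter, not_and] at hx
    have : n.factorization x = 0 := by
      by_contra h
      exact hx.2 (Finsupp.mem_support_iff.2 h) hx.1
    simp [this]
  · intros; rfl

theorem piPart_filter (π : Set ℕ) (n : ℕ) :
    piPart π n = ∏ p ∈ n.primeFactors.filter (· ∈ π), p ^ n.factorization p := by
  unfold piPart Finsupp.prod
  rw [← Finset.prod_filter]; rfl

theorem kPi_filter (π : Set ℕ) (G : Type*) [Group G] [Finite G] :
    kPi π G = kPi (((Nat.card G).primeFactors.filter (· ∈ π) : Finset ℕ) : Set ℕ) G := by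
  have : ∀ x : G, IsPiElement π x ↔
      IsPiElement (((Nat.card G).primeFactors.filter (· ∈ π) : Finset ℕ) : Set ℕ) x := by
    intro x
    refine forall₃_congr fun q hq hqx => ?_
    have := hqx.trans (orderOf_dvd_natCard x)
    simp [hq, this, Nat.card_pos.ne']
  unfold kPi
  simp only [this]

theorem isPi_of_isConj {G : Type*} [Group G] (π : Set ℕ) {x y : G} (h : IsConj x y)
    (hx : IsPiElement π x) : IsPiElement π y := by
  obtain ⟨g, rfl⟩ := isConj_iff.1 h
  have : orderOf (g * x * g⁻¹) = orderOf x :=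
    orderOf_injective (MulAut.conj g).toMonoidHom (MulAut.conj g).injective x
  intro q hq hd
  exact hx q hq (this ▸ hd)

theorem kPi_insert_le.{u} {G : Type u} [Group G] [Finite G] (p : ℕ) (hp : p.Prime) (s : Set ℕ) (B : ℕ)
    (hB : ∀ C : Subgroup G, kPi s C ≤ B) : kPi (insert p s) G ≤ kPi {p} G * B := by
  let A := {c : ConjClasses G | ∃ x : G, ConjClasses.mk x = c ∧ IsPiElement {p} x}
  let D := {c : ConjClasses G | ∃ x : G, ConjClasses.mk x = c ∧ IsPiElement (insert p s) x}
  have hr : ∀ c : A, ∃ u : G, ConjClasses.mk u = c.1 := fun c => ⟨_, c.2.choose_spec.1⟩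
  choose u hu using hr
  let E := fun c : A => {e : ConjClasses (Subgroup.centralizer {u c}) |
    ∃ x, ConjClasses.mk x = e ∧ IsPiElement s x}
  have hex : ∀ d : D, ∃ ce : (Σ c : A, E c), ∃ v : Subgroup.centralizer {u ce.1},
      ConjClasses.mk v = ce.2.1 ∧ ConjClasses.mk (u ce.1 * v) = d.1 := by
    rintro ⟨d, x, rfl, hx⟩
    obtain ⟨k, l, a, m, hpm, hm, hl, hk, hkl⟩ := crt_split p (orderOf x) hp (orderOf_pos x).ne'
    obtain ⟨hxs, hxp, hxm⟩ := split_elem x hpm hl hk hkl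
    have hxk : IsPiElement {p} (x ^ k) := by
      intro q hq hqd
      exact (Nat.prime_dvd_prime_iff_eq hq hp).1
        (hq.dvd_of_dvd_pow (hqd.trans (orderOf_dvd_of_pow_eq_one hxp)))
    have hxl : IsPiElement s (x ^ l) := by
      intro q hq hqd
      rcases hx q hq (hqd.trans (orderOf_pow_dvd l)) with h | h
      · subst h
        exact absurd (hqd.trans (orderOf_dvd_of_pow_eq_one hxm)) hm
      · exact h
    let c : A := ⟨ConjClasses.mk (x ^ k), x ^ k, rfl, hxk⟩
    obtain ⟨g, hg⟩ := isConj_iff.1 (ConjClasses.mk_eq_mk_iff_isConj.1 (hu c).symm)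
    have hv : g * x ^ l * g⁻¹ ∈ Subgroup.centralizer {u c} := by
      rw [Subgroup.mem_centralizer_singleton_iff, ← hg]
      have := ((Commute.refl x).pow_pow l k).eq
      calc g * x ^ l * g⁻¹ * (g * x ^ k * g⁻¹) = g * (x ^ l * x ^ k) * g⁻¹ := by group
        _ = g * (x ^ k * x ^ l) * g⁻¹ := by rw [this]
        _ = _ := by group
    refine ⟨⟨c, ⟨ConjClasses.mk ⟨_, hv⟩, ⟨_, hv⟩, rfl, ?_⟩⟩, ⟨_, hv⟩, rfl, ?_⟩
    · have := isPi_of_isConj s (isConj_iff.2 ⟨g, rfl⟩) hxl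
      intro q hq hqd
      rw [Subgroup.orderOf_mk] at hqd
      exact this q hq hqd
    · rw [ConjClasses.mk_eq_mk_iff_isConj]
      refine IsConj.symm (isConj_iff.2 ⟨g, ?_⟩)
      change g * x * g⁻¹ = u c * (g * x ^ l * g⁻¹)
      rw [← hg]
      conv_lhs => rw [← hxs]
      simp [mul_assoc]
  choose f v hv1 hv2 using hex
  have hf : Function.Injective f := by
    intro d d' hdd
    have key : ∀ ce ce' : (Σ c : A, E c), ce = ce' →
        ∀ (w : Subgroup.centralizer {u ce.1}) (w' : Subgroup.centralizer {u ce'.1}),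
        ConjClasses.mk w = ce.2.1 → ConjClasses.mk w' = ce'.2.1 →
        ConjClasses.mk (u ce.1 * w) = ConjClasses.mk (u ce'.1 * w') := by
      rintro ce _ rfl w w' h h'
      obtain ⟨g, hg⟩ := isConj_iff.1 (ConjClasses.mk_eq_mk_iff_isConj.1 (h.trans h'.symm))
      rw [ConjClasses.mk_eq_mk_iff_isConj]
      refine isConj_iff.2 ⟨g, ?_⟩
      have h1 := Subgroup.mem_centralizer_singleton_iff.1 g.2
      rw [← hg]
      simp only [Subgroup.coe_mul, Subgroup.coe_inv]
      rw [← mul_assoc, h1]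
      simp [mul_assoc]
    have := key _ _ hdd (v d) (v d') (hv1 d) (hv1 d')
    rw [hv2, hv2] at this
    exact Subtype.ext this
  have hfin : ∀ c : A, Finite (E c) := fun c => inferInstance
  have hA : Fintype A := Fintype.ofFinite A
  calc kPi (insert p s) G = Nat.card D := rfl
    _ ≤ Nat.card (Σ c : A, E c) := Nat.card_le_card_of_injective f hf
    _ = ∑ c : A, Nat.card (E c) := Nat.card_sigma
    _ ≤ ∑ c : A, B := Finset.sum_le_sum fun c _ => hB _
    _ = kPi {p} G * B := by
      rw [Finset.sum_const, Finset.card_univ, smul_eq_mul, ← Nat.card_eq_fintype_card]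
      rfl

theorem sylow_surj {G : Type*} [Group G] [Finite G] (p : ℕ) [hp : Fact p.Prime] (P : Sylow p G) :
    ∃ f : P → {c : ConjClasses G | ∃ x : G, ConjClasses.mk x = c ∧ IsPiElement {p} x},
      Function.Surjective f ∧ ∀ x, (f x).1 = ConjClasses.mk (x : G) := by
  refine ⟨fun x => ⟨ConjClasses.mk (x : G), x, rfl, ?_⟩, ?_, fun x => rfl⟩
  · obtain ⟨k, hk⟩ := IsPGroup.iff_orderOf.1 P.2 x
    intro q hq hqd
    rw [Subgroup.orderOf_coe, hk] at hqd
    exact (Nat.prime_dvd_prime_iff_eq hq hp.out).1 (hq.dvd_of_dvd_pow hqd)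
  · rintro ⟨c, x, rfl, hx⟩
    have hxo := Nat.eq_prime_pow_of_unique_prime_dvd (orderOf_pos x).ne' (fun {d} h1 h2 => hx d h1 h2)
    have hpg : IsPGroup p (Subgroup.zpowers x) :=
      IsPGroup.of_card (n := (orderOf x).primeFactorsList.length) (by rw [Nat.card_zpowers]; exact hxo)
    obtain ⟨Q, hQ⟩ := hpg.exists_le_sylow
    obtain ⟨g, hg⟩ := MulAction.exists_smul_eq G Q P
    have hxQ : x ∈ Q := hQ (Subgroup.mem_zpowers x)
    have hm : g * x * g⁻¹ ∈ P := by
      rw [← hg]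
      exact Subgroup.smul_mem_pointwise_smul x (MulAut.conj g) Q.1 hxQ
    refine ⟨⟨_, hm⟩, Subtype.ext ?_⟩
    exact ConjClasses.mk_eq_mk_iff_isConj.2 (isConj_iff.2 ⟨g, rfl⟩).symm

theorem kPi_singleton_le {G : Type*} [Group G] [Finite G] (p : ℕ) (hp : p.Prime) :
    kPi {p} G ≤ p ^ (Nat.card G).factorization p := by
  have : Fact p.Prime := ⟨hp⟩
  let P : Sylow p G := default
  obtain ⟨f, hf, -⟩ := sylow_surj p P
  rw [← P.card_eq_multiplicity]
  exact Nat.card_le_card_of_surjective f hf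

theorem p_compl {G : Type*} [Group G] [Finite G] (p : ℕ) (hp : p.Prime)
    (h : p ^ (Nat.card G).factorization p ≤ kPi {p} G) :
    ∃ K : Subgroup G, K.Normal ∧ ¬ p ∣ Nat.card K ∧ K.index = p ^ (Nat.card G).factorization p ∧
      ∀ x y : G, x * y * x⁻¹ * y⁻¹ ∈ K := by
  have : Fact p.Prime := ⟨hp⟩
  let P : Sylow p G := default
  obtain ⟨f, hf, hf'⟩ := sylow_surj p P
  have hinj : Function.Injective f := by
    refine ((Nat.bijective_iff_surjective_and_card f).2 ⟨hf, ?_⟩).1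
    apply le_antisymm _ (Nat.card_le_card_of_surjective f hf)
    exact (le_of_eq P.card_eq_multiplicity).trans h
  have hfus : ∀ x y : P, IsConj (x : G) y → x = y := fun x y hxy => hinj (Subtype.ext (by
    rw [hf', hf']; exact ConjClasses.mk_eq_mk_iff_isConj.2 hxy))
  have hP : Subgroup.normalizer P ≤ Subgroup.centralizer (P : Set G) := by
    intro g hg
    rw [Subgroup.mem_centralizer_iff]
    intro x hx
    have h1 : g * x * g⁻¹ ∈ P := (Subgroup.mem_normalizer_iff.1 hg x).1 hx
    have h2 := hfus ⟨x, hx⟩ ⟨_, h1⟩ (isConj_iff.2 ⟨g, rfl⟩)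
    have h3 : x = g * x * g⁻¹ := congrArg Subtype.val h2
    conv_lhs => rw [h3]
    simp
  have hcomm : ∀ x y : P, x * y = y * x := fun x y =>
    Subtype.ext (hP (Subgroup.le_normalizer y.2) x x.2)
  refine ⟨(MonoidHom.transferSylow P hP).ker, inferInstance,
    MonoidHom.not_dvd_card_ker_transferSylow P hP, ?_, ?_⟩
  · rw [← P.card_eq_multiplicity]
    exact (MonoidHom.ker_transferSylow_isComplement' P hP).symm.index_eq_card
  · intro x y
    rw [MonoidHom.mem_ker]
    simp only [map_mul, map_inv]
    rw [hcomm (MonoidHom.transferSylow P hP x)]; simp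

theorem kPi_le.{u} (s : Finset ℕ) : (∀ p ∈ s, p.Prime) → ∀ (G : Type u) [Group G] [Finite G],
    kPi (s : Set ℕ) G ≤ ∏ p ∈ s, p ^ (Nat.card G).factorization p := by
  induction s using Finset.induction_on with
  | empty =>
    intro _ G _ _
    simp only [Finset.prod_empty]
    refine Finite.card_le_one_iff_subsingleton.2 ⟨?_⟩
    have : ∀ x : G, IsPiElement ((∅ : Finset ℕ) : Set ℕ) x → x = 1 := by
      intro x hx
      by_contra h
      obtain ⟨q, hq, hqd⟩ := Nat.exists_prime_and_dvd (mt orderOf_eq_one_iff.1 h)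
      simpa using hx q hq hqd
    rintro ⟨_, x, rfl, hx⟩ ⟨_, y, rfl, hy⟩
    rw [Subtype.mk.injEq, this x hx, this y hy]
  | insert p s hps ih =>
    intro hs G _ _
    have hp := hs p (Finset.mem_insert_self p s)
    have hs' : ∀ q ∈ s, q.Prime := fun q hq => hs q (Finset.mem_insert_of_mem hq)
    rw [Finset.coe_insert, Finset.prod_insert hps]
    refine (kPi_insert_le p hp s (∏ p ∈ s, p ^ (Nat.card G).factorization p) ?_).trans
      (Nat.mul_le_mul_right _ (kPi_singleton_le p hp))
    intro C
    refine (ih hs' C).trans (Finset.prod_le_prod' fun q hq => ?_)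
    exact Nat.pow_le_pow_right (hs' q hq).pos
      ((Nat.factorization_le_iff_dvd Nat.card_pos.ne' Nat.card_pos.ne').2
        C.card_subgroup_dvd_card q)

theorem p_compl_of_eq {G : Type*} [Group G] [Finite G] (s : Finset ℕ) (hs : ∀ p ∈ s, p.Prime)
    (h : kPi (s : Set ℕ) G = ∏ p ∈ s, p ^ (Nat.card G).factorization p) (p : ℕ) (hp : p ∈ s) :
    p ^ (Nat.card G).factorization p ≤ kPi {p} G := by
  have hs' : ∀ q ∈ s.erase p, q.Prime := fun q hq => hs q (Finset.mem_of_mem_erase hq)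
  have h1 := kPi_insert_le (G := G) p (hs p hp) (s.erase p : Finset ℕ)
    (∏ q ∈ s.erase p, q ^ (Nat.card G).factorization q) (by
      intro C
      refine (kPi_le _ hs' C).trans (Finset.prod_le_prod' fun q hq => ?_)
      exact Nat.pow_le_pow_right (hs' q hq).pos
        ((Nat.factorization_le_iff_dvd Nat.card_pos.ne' Nat.card_pos.ne').2
          C.card_subgroup_dvd_card q))
  rw [← Finset.coe_insert, Finset.insert_erase hp, h, ← Finset.mul_prod_erase s _ hp] at h1
  exact Nat.le_of_mul_le_mul_right h1 (Finset.prod_pos fun q hq => pow_pos (hs' q hq).pos _)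

theorem prime_dvd_piPart {π : Set ℕ} {n q : ℕ} (hq : q.Prime) (h : q ∣ piPart π n) : q ∈ π := by
  rw [piPart_filter] at h
  obtain ⟨p, hp, hd⟩ := (hq.prime.dvd_finsetProd_iff _).1 h
  rw [Finset.mem_filter] at hp
  rw [(Nat.prime_dvd_prime_iff_eq hq (Nat.prime_of_mem_primeFactors hp.1)).1 (hq.dvd_of_dvd_pow hd)]
  exact hp.2

theorem dPi_eq_one_iff_kPi {G : Type*} [Group G] (π : Set ℕ) :
    dPi π G = 1 ↔ kPi π G = piPart π (Nat.card G) := by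
  have h0 : piPart π (Nat.card G) ≠ 0 := by
    rw [piPart_filter]
    refine Finset.prod_ne_zero_iff.2 fun p hp => ?_
    exact pow_ne_zero _ (Nat.prime_of_mem_primeFactors (Finset.mem_filter.1 hp).1).ne_zero
  unfold dPi
  rw [div_eq_one_iff_eq (by exact_mod_cast h0)]
  norm_cast

theorem forward {G : Type*} [Group G] [Finite G] (π : Set ℕ)
    (h : kPi π G = piPart π (Nat.card G)) :
    ∃ N : Subgroup G, N.Normal ∧ (∀ p ∈ π, p.Prime → ¬ p ∣ Nat.card N) ∧
        N.index = piPart π (Nat.card G) ∧ ∀ x y : G, x * y * x⁻¹ * y⁻¹ ∈ N := by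
  rw [kPi_filter, piPart_filter] at h
  rw [piPart_filter]
  set s := (Nat.card G).primeFactors.filter (· ∈ π) with hsdef
  have hs : ∀ p ∈ s, p.Prime := fun p hp => Nat.prime_of_mem_primeFactors (Finset.mem_filter.1 hp).1
  have hK : ∀ p : s, ∃ K : Subgroup G, K.Normal ∧ ¬ p.1 ∣ Nat.card K ∧
      K.index = p.1 ^ (Nat.card G).factorization p ∧ ∀ x y : G, x * y * x⁻¹ * y⁻¹ ∈ K :=
    fun p => p_compl p.1 (hs p p.2) (p_compl_of_eq s hs h p p.2)
  choose K hKn hKc hKi hKab using hK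
  refine ⟨⨅ p, K p, Subgroup.normal_iInf_normal hKn, ?_, ?_, ?_⟩
  · intro p hpπ hp hpd
    have hps : p ∈ s := by
      simp only [hsdef, Finset.mem_filter, Nat.mem_primeFactors]
      exact ⟨⟨hp, hpd.trans (Subgroup.card_subgroup_dvd_card _), Nat.card_pos.ne'⟩, hpπ⟩
    exact hKc ⟨p, hps⟩ (hpd.trans (Subgroup.card_dvd_of_le (iInf_le _ _)))
  · apply le_antisymm
    · refine (Subgroup.index_iInf_le K).trans (le_of_eq ?_)
      simp only [hKi]
      exact Finset.prod_coe_sort s (fun p => p ^ (Nat.card G).factorization p)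
    · refine Nat.le_of_dvd (Nat.pos_of_ne_zero Subgroup.index_ne_zero_of_finite) ?_
      refine Finset.prod_dvd_of_isRelPrime ?_ ?_
      · intro p hp q hq hpq
        exact Nat.coprime_iff_isRelPrime.1 
          (Nat.Coprime.pow _ _ ((Nat.coprime_primes (hs p hp) (hs q hq)).2 hpq))
      · intro p hp
        rw [← hKi ⟨p, hp⟩]
        exact Subgroup.index_dvd_of_le (iInf_le _ _)
  · intro x y
    rw [Subgroup.mem_iInf]
    exact fun p => hKab p x y

theorem backward {G : Type*} [Group G] [Finite G] (π : Set ℕ)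
    (N H : Subgroup G) [N.Normal] (hN : ∀ p ∈ π, ¬ p ∣ Nat.card N)
    (hi : N.index = piPart π (Nat.card G)) (hH : Nat.card H = piPart π (Nat.card G))
    (hab : ∀ x y : H, x * y = y * x) : kPi π G = piPart π (Nat.card G) := by
  have hco : Nat.Coprime (Nat.card N) (Nat.card H) := Nat.coprime_of_dvd fun q hq h1 h2 =>
    hN q (prime_dvd_piPart hq (hH ▸ h2)) h1
  have hcompl : Subgroup.IsComplement' N H := by
    refine Subgroup.isComplement'_of_coprime ?_ hco
    rw [hH, ← hi, N.card_mul_index]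
  have hdec : ∀ g : G, ∃ h : H, (g : G ⧸ N) = (h : G) := by
    intro g
    obtain ⟨⟨n, h⟩, hnh⟩ := hcompl.2 g
    refine ⟨h, ?_⟩
    have hn := (QuotientGroup.eq_one_iff (n : G)).2 n.2
    have hnh' : (n : G) * h = g := hnh
    rw [← hnh', QuotientGroup.mk_mul, hn, one_mul]
  have hcomm : ∀ g k : G, (g : G ⧸ N) * k = k * g := by
    intro g k
    obtain ⟨a, ha⟩ := hdec g
    obtain ⟨b, hb⟩ := hdec k
    rw [ha, hb, ← QuotientGroup.mk_mul, ← QuotientGroup.mk_mul]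
    exact congrArg (fun t : H => ((t : G) : G ⧸ N)) (hab a b)
  have hHpi : ∀ h : H, IsPiElement π (h : G) := by
    intro h q hq hqd
    rw [Subgroup.orderOf_coe] at hqd
    exact prime_dvd_piPart hq (hH ▸ hqd.trans (orderOf_dvd_natCard h))
  have hpico : ∀ x : G, IsPiElement π x → (orderOf x).Coprime (Nat.card N) := fun x hx =>
    Nat.coprime_of_dvd fun q hq h1 h2 => hN q (hx q hq h1) h2
  rw [← hH]
  symm
  refine Nat.card_eq_of_bijective (fun h : H => (⟨ConjClasses.mk (h : G), h, rfl, hHpi h⟩ :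
    {c : ConjClasses G | ∃ x : G, ConjClasses.mk x = c ∧ IsPiElement π x})) ⟨?_, ?_⟩
  · intro a b hab'
    obtain ⟨g, hg⟩ := isConj_iff.1 (ConjClasses.mk_eq_mk_iff_isConj.1 (congrArg Subtype.val hab'))
    have h1 : ((a : G) : G ⧸ N) = (b : G) := by
      rw [← hg, QuotientGroup.mk_mul, QuotientGroup.mk_mul, hcomm g a, QuotientGroup.mk_inv]
      simp
    rw [QuotientGroup.eq] at h1
    have h2 := Subgroup.disjoint_def.1 hcompl.disjoint h1 (H.mul_mem (H.inv_mem a.2) b.2)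
    exact Subtype.ext (inv_mul_eq_one.1 h2)
  · rintro ⟨_, x, rfl, hx⟩
    obtain ⟨h, hh⟩ := hdec x
    refine ⟨h, Subtype.ext ?_⟩
    exact ConjClasses.mk_eq_mk_iff_isConj.2
      (conj_of_coset _ N x h (hpico x hx) (hpico h (hHpi h)) hh rfl).symm

/-- `d_π(G) = 1` if and only if `G` has a normal `π`-complement and an abelian
Hall `π`-subgroup. -/
theorem dPi_eq_one_iff
    {G : Type*} [Group G] [Finite G] (π : Set ℕ)
    (hπ : ∀ p ∈ π, Nat.Prime p) (hne : π.Nonempty) :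
    dPi π G = 1 ↔
      (∃ N : Subgroup G, N.Normal ∧ (∀ p ∈ π, ¬ p ∣ Nat.card N) ∧
        N.index = piPart π (Nat.card G)) ∧
      (∃ H : Subgroup G, Nat.card H = piPart π (Nat.card G) ∧
        ∀ x y : H, x * y = y * x) := by
  rw [dPi_eq_one_iff_kPi]
  constructor
  · intro h
    obtain ⟨N, hNn, hNc, hNi, hNab⟩ := forward π h
    have hco : Nat.Coprime (Nat.card N) N.index := Nat.coprime_of_dvd fun q hq h1 h2 =>
      hNc q (prime_dvd_piPart hq (hNi ▸ h2)) hq h1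
    obtain ⟨H, hH⟩ := Subgroup.exists_right_complement'_of_coprime hco
    refine ⟨⟨N, hNn, fun p hp => hNc p hp (hπ p hp), hNi⟩, H, ?_, ?_⟩
    · rw [← hNi, hH.symm.index_eq_card]
    · intro x y
      have h1 := Subgroup.disjoint_def.1 hH.disjoint (hNab x y) (x * y * x⁻¹ * y⁻¹).2
      have h2 : x * y * x⁻¹ * y⁻¹ = 1 := Subtype.ext h1
      rw [mul_inv_eq_one, mul_inv_eq_iff_eq_mul] at h2
      exact h2
  · rintro ⟨⟨N, hNn, hNc, hNi⟩, H, hH, hab⟩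
    exact backward π N H hNc hNi hH hab
end

section
/- Let G be a finite group of odd order. If d_3(G) < 1, then d_3(G) ≤ 7/15. -/
open scoped Classical Pointwise

/-- Counting the image of a map whose fibres off `S` are large. -/
lemma aux_count {α β : Type*} [Fintype α] (f : α → β) (S : Set α) (m : ℕ) (hm : 1 ≤ m)
    (hS : ∀ x, x ∉ S → m ≤ (Finset.univ.filter fun y => f y = f x).card) :
    m * (Set.range f).ncard ≤ (m - 1) * S.ncard + Fintype.card α := by
  have h1 : (Set.range f).ncard = (Finset.univ.image f).card := by
    rw [← Set.ncard_coe_finset]; congr 1; ext; simp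
  have h2 : S.ncard = (S.toFinset).card := by
    rw [← Set.ncard_coe_finset]; congr 1; ext; simp
  have h3 := Finset.card_eq_sum_card_image f (Finset.univ : Finset α)
  have h4 : S.toFinset.card = ∑ b ∈ Finset.univ.image f, (S.toFinset.filter fun y => f y = b).card :=
    Finset.card_eq_sum_card_fiberwise (fun x _ => by simp)
  rw [h1, h2, h4, ← Finset.card_univ, h3, Finset.mul_sum, ← Finset.sum_add_distrib, mul_comm,
    ← smul_eq_mul, ← Finset.sum_const]
  apply Finset.sum_le_sum
  intro b hb
  obtain ⟨x, -, rfl⟩ := Finset.mem_image.1 hb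
  by_cases hx : ∃ y ∈ S, f y = f x
  · obtain ⟨y, hy, hyx⟩ := hx
    have a1 : 0 < (S.toFinset.filter fun y => f y = f x).card :=
      Finset.card_pos.2 ⟨y, by simp [hy, hyx]⟩
    have a2 : 0 < (Finset.univ.filter fun y => f y = f x).card :=
      Finset.card_pos.2 ⟨y, by simp [hyx]⟩
    have : (m - 1) * 1 ≤ (m - 1) * (S.toFinset.filter fun y => f y = f x).card :=
      Nat.mul_le_mul_left _ a1
    omega
  · push Not at hx
    have := hS x (fun hxS => hx x hxS rfl)
    omega

/-- Fibres of the class map on a subgroup contain orbits of normalizing elements. -/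
lemma aux_fiber {G : Type*} [Group G] (P : Subgroup G) [Fintype P] (g : G)
    (hg : g ∈ Subgroup.normalizer (P : Set G)) (m : ℕ)
    (hm : ∀ d, d ∣ orderOf g → d ≠ 1 → m ≤ d) (x : P) (hx : g * x * g⁻¹ ≠ x) :
    m ≤ (Finset.univ.filter fun y : P =>
      ConjClasses.mk (y : G) = ConjClasses.mk (x : G)).card := by
  have hit : ∀ n : ℕ, (fun z : G => g * z * g⁻¹)^[n] x = g ^ n * x * (g ^ n)⁻¹ := by
    intro n
    induction n with
    | zero => simp
    | succ k ih => rw [Function.iterate_succ_apply', ih]; simp [pow_succ', mul_assoc]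
  set c : G → G := fun z => g * z * g⁻¹ with hc
  have hd : Function.minimalPeriod c (x : G) ∣ orderOf g := by
    apply Function.IsPeriodicPt.minimalPeriod_dvd
    show c^[orderOf g] x = x
    rw [hit]; simp [pow_orderOf_eq_one]
  have h1 : Function.minimalPeriod c (x : G) ≠ 1 := by
    intro h
    exact hx (Function.minimalPeriod_eq_one_iff_isFixedPt.1 h)
  refine (hm _ hd h1).trans ?_
  have hmem : ∀ n : ℕ, g ^ n * (x : G) * (g ^ n)⁻¹ ∈ P := fun n =>
    ((Subgroup.mem_normalizer_iff.1 (pow_mem hg n)) x).1 x.2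
  rw [← Finset.card_range (Function.minimalPeriod c (x : G))]
  apply Finset.card_le_card_of_injOn (fun n => ⟨g ^ n * (x : G) * (g ^ n)⁻¹, hmem n⟩)
  · intro n _
    simp only [Finset.coe_filter, Finset.mem_univ, true_and, Set.mem_ofPred_eq,
      ConjClasses.mk_eq_mk_iff_isConj]
    exact (isConj_iff.2 ⟨g ^ n, rfl⟩ : IsConj (x : G) _).symm
  · intro a ha b hb hab
    have hab' := congrArg Subtype.val hab
    simp only [← hit] at hab'
    exact Function.iterate_injOn_Iio_minimalPeriod (by simpa using ha) (by simpa using hb) hab'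

lemma aux_pow3 {d k : ℕ} (h : d ∣ 3 ^ k) (h1 : d ≠ 1) : 3 ≤ d := by
  obtain ⟨j, -, rfl⟩ := (Nat.dvd_prime_pow Nat.prime_three).1 h
  rcases j with _ | j
  · simp at h1
  · have := Nat.one_le_pow j 3 (by norm_num); rw [pow_succ]; omega

lemma aux_pow9 {d k : ℕ} (h : d ∣ 3 ^ k) (h1 : d ≠ 1) (h3 : d ≠ 3) : 9 ≤ d := by
  obtain ⟨j, -, rfl⟩ := (Nat.dvd_prime_pow Nat.prime_three).1 h
  rcases j with _ | _ | j
  · simp at h1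
  · simp at h3
  · have := Nat.one_le_pow j 3 (by norm_num); rw [pow_succ, pow_succ]; omega

lemma aux_piPart (n : ℕ) : piPart {3} n = 3 ^ n.factorization 3 := by
  unfold piPart
  rw [Finsupp.prod, Finset.prod_eq_single 3]
  · simp
  · intro b _ hb; simp [hb]
  · intro h; simp at h; simp [Nat.factorization_eq_zero_iff]; tauto

lemma aux_kPi {G : Type*} [Group G] [Finite G] (P : Sylow 3 G) :
    kPi {3} G = (Set.range fun y : (P : Subgroup G) => ConjClasses.mk (y : G)).ncard := by
  have : Fact (Nat.Prime 3) := ⟨Nat.prime_three⟩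
  unfold kPi
  rw [Nat.card_coe_set_eq]
  congr 1
  ext c
  simp only [Set.mem_ofPred_eq, Set.mem_range]
  constructor
  · rintro ⟨x, rfl, hx⟩
    have hx3 : orderOf x = 3 ^ (orderOf x).primeFactorsList.length :=
      Nat.eq_prime_pow_of_unique_prime_dvd (orderOf_pos x).ne' (fun {d} hd hdx => by
        simpa using hx d hd hdx)
    have hp : IsPGroup 3 (Subgroup.zpowers x) :=
      IsPGroup.of_card (by rw [Nat.card_zpowers]; exact hx3)
    obtain ⟨Q, hQ⟩ := hp.exists_le_sylow
    obtain ⟨g, rfl⟩ := MulAction.exists_smul_eq G P Q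
    have hxQ := hQ (Subgroup.mem_zpowers x)
    have hxQ' : x ∈ MulAut.conj g • (P : Subgroup G) := hxQ
    obtain ⟨y, hy, hyx⟩ := (Set.mem_smul_set).1 hxQ'
    refine ⟨⟨y, hy⟩, ?_⟩
    rw [ConjClasses.mk_eq_mk_iff_isConj, isConj_iff]
    exact ⟨g, by simpa using hyx⟩
  · rintro ⟨y, rfl⟩
    refine ⟨y, rfl, ?_⟩
    intro q hq hqd
    obtain ⟨k, hk⟩ := IsPGroup.iff_orderOf.1 P.2 y
    rw [Subgroup.orderOf_coe, hk] at hqd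
    simpa using (Nat.prime_dvd_prime_iff_eq hq Nat.prime_three).1 (hq.dvd_of_dvd_pow hqd)

/-- If `G` has odd order and `d_3(G) < 1`, then `d_3(G) ≤ 7/15`. -/
theorem dThree_le_seven_fifteenths_of_odd
    {G : Type*} [Group G] [Finite G]
    (hodd : Odd (Nat.card G)) (h : dPi {3} G < 1) :
    dPi {3} G ≤ 7 / 15 := by
  have : Fact (Nat.Prime 3) := ⟨Nat.prime_three⟩
  obtain ⟨P⟩ : Nonempty (Sylow 3 G) := inferInstance
  let : Fintype (P : Subgroup G) := Fintype.ofFinite _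
  have hP : piPart {3} (Nat.card G) = Nat.card P := by
    rw [aux_piPart, P.card_eq_multiplicity]
  obtain ⟨k, hk⟩ := IsPGroup.iff_card.1 P.2
  have hpos : 0 < Nat.card P := Nat.card_pos
  unfold dPi at h ⊢
  rw [hP] at h ⊢
  have hposQ : (0 : ℚ) < Nat.card P := by exact_mod_cast hpos
  rw [div_lt_one hposQ] at h
  rw [div_le_iff₀ hposQ]
  suffices hs : 15 * kPi {3} G ≤ 7 * Nat.card P by
    have : (15 : ℚ) * kPi {3} G ≤ 7 * Nat.card P := by exact_mod_cast hs
    linarith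
  have h' : kPi {3} G < Nat.card P := by exact_mod_cast h
  rw [aux_kPi P] at h' ⊢
  set f : ↥(P : Subgroup G) → ConjClasses G := fun y => ConjClasses.mk (y : G) with hf
  have hninj : ¬ Function.Injective f := by
    intro hi
    rw [← Set.image_univ, Set.ncard_image_of_injective _ hi, Set.ncard_univ] at h'
    exact lt_irrefl _ h'
  by_cases hab : IsMulCommutative P
  · obtain ⟨x, y, hxy, hne⟩ : ∃ x y : ↥(P : Subgroup G), f x = f y ∧ x ≠ y := by
      simpa [Function.Injective] using hninj
    have hcomm : ∀ a ∈ P, ∀ b ∈ P, a * b = b * a := fun a ha b hb =>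
      congrArg Subtype.val (mul_comm' (⟨a, ha⟩ : P) ⟨b, hb⟩)
    obtain ⟨g, hg⟩ := isConj_iff.1 (ConjClasses.mk_eq_mk_iff_isConj.1 hxy)
    obtain ⟨n, hn, hnx⟩ := P.conj_eq_normalizer_conj_of_mem (x : G) g⁻¹ x.2
      (by simp [hg])
    have hnx' : ¬ Commute n (x : G) := by
      intro hc
      apply hne
      ext
      rw [inv_inv, hg, mul_assoc, ← hc.eq, inv_mul_cancel_left] at hnx
      exact hnx.symm
    set o := orderOf n with ho
    have hopos : o ≠ 0 := (orderOf_pos n).ne'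
    set a := 3 ^ o.factorization 3 with ha
    set b := o / a with hb
    have hab : a * b = o := Nat.ordProj_mul_ordCompl_eq_self o 3
    have hcop : Nat.Coprime 3 b := Nat.coprime_ordCompl Nat.prime_three hopos
    have hcop' : Nat.Coprime a b := hcop.pow_left _
    have hapos : a ≠ 0 := by positivity
    have hbpos : b ≠ 0 := by rintro h0; rw [h0] at hab; simp at hab; exact hopos hab.symm
    have hoa : orderOf (n ^ a) = b := by
      rw [orderOf_pow_of_dvd hapos ⟨b, hab.symm⟩]
    have hob : orderOf (n ^ b) = a := by
      rw [orderOf_pow_of_dvd hbpos ⟨a, by rw [mul_comm]; exact hab.symm⟩, ← ho, ← hab,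
        Nat.mul_div_cancel _ (Nat.pos_of_ne_zero hbpos)]
    have hnb : n ^ b ∈ P := by
      have hp : IsPGroup 3 (Subgroup.zpowers (n ^ b)) :=
        IsPGroup.of_card (n := o.factorization 3) (by rw [Nat.card_zpowers, hob])
      have hmem : n ^ b ∈ Subgroup.zpowers (n ^ b) ⊓ Subgroup.normalizer (P : Set G) :=
        ⟨Subgroup.mem_zpowers _, pow_mem hn b⟩
      rw [hp.inf_normalizer_sylow] at hmem
      exact hmem.2
    have hcb : Commute (n ^ b) (x : G) := hcomm _ hnb _ x.2
    have hca : ¬ Commute (n ^ a) (x : G) := by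
      intro hca
      apply hnx'
      have hbz : (1 : ℤ) = a * Nat.gcdA a b + b * Nat.gcdB a b := by
        rw [← Nat.gcd_eq_gcd_ab, hcop']; rfl
      have : n = (n ^ a) ^ (Nat.gcdA a b) * (n ^ b) ^ (Nat.gcdB a b) := by
        rw [← zpow_natCast n a, ← zpow_natCast n b, ← zpow_mul, ← zpow_mul, ← zpow_add, ← hbz,
          zpow_one]
      rw [this]
      exact (hca.zpow_left _).mul_left (hcb.zpow_left _)
    have hm5 : ∀ d, d ∣ orderOf (n ^ a) → d ≠ 1 → 5 ≤ d := by
      intro d hd hd1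
      have hdo : Odd d := hodd.of_dvd_nat (hd.trans (orderOf_dvd_natCard _))
      rw [hoa] at hd
      have hd3 : d ≠ 3 := by
        rintro rfl
        have := Nat.dvd_gcd (dvd_refl 3) hd
        rw [hcop] at this
        norm_num at this
      obtain ⟨t, rfl⟩ := hdo
      omega
    set C := (Subgroup.centralizer {n ^ a}).subgroupOf (P : Subgroup G) with hC
    have hmemC : ∀ y : ↥(P : Subgroup G), y ∈ C ↔ Commute (n ^ a) (y : G) := by
      intro y
      rw [hC, Subgroup.mem_subgroupOf, Subgroup.mem_centralizer_singleton_iff]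
      exact ⟨fun h => h.symm, fun h => h.symm⟩
    have hi : C.index ∣ 3 ^ k := hk ▸ C.index_dvd_card
    have hi1 : C.index ≠ 1 := by
      rw [Ne, Subgroup.index_eq_one]
      intro htop
      exact hca ((hmemC x).1 (htop ▸ Subgroup.mem_top x))
    have h3 := aux_pow3 hi hi1
    have hc := C.card_mul_index
    have := aux_count f (C : Set (P : Subgroup G)) 5 (by norm_num) (by
      intro y hy
      refine (aux_fiber (P : Subgroup G) (n ^ a) (pow_mem hn a) 5 hm5 y ?_).trans
        (le_of_eq (by congr!))
      intro he
      exact hy ((hmemC y).2 (mul_inv_eq_iff_eq_mul.1 he)))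
    rw [← Nat.card_eq_fintype_card] at this
    have hz : (C : Set (P : Subgroup G)).ncard = Nat.card C := rfl
    rw [hz] at this
    nlinarith
  · set Z := Subgroup.center P with hZ
    have hi : Z.index ∣ 3 ^ k := hk ▸ Z.index_dvd_card
    have hi1 : Z.index ≠ 1 := by
      rw [Ne, Subgroup.index_eq_one, Subgroup.center_eq_top_iff]; exact hab
    have hi3 : Z.index ≠ 3 := by
      intro h3
      have : IsCyclic (P ⧸ Subgroup.center P) := isCyclic_of_prime_card (p := 3) h3
      exact hab (isMulCommutative_of_isCyclic_quotient_center_self _)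
    have h9 := aux_pow9 hi hi1 hi3
    have hc := Z.card_mul_index
    have := aux_count f (Z : Set (P : Subgroup G)) 3 (by norm_num) (by
      intro x hx
      have : ∃ g : ↥(P : Subgroup G), g * x ≠ x * g := by
        by_contra hcon; push Not at hcon
        exact hx (Subgroup.mem_center_iff.2 hcon)
      obtain ⟨g, hgx⟩ := this
      refine (aux_fiber (P : Subgroup G) g (Subgroup.le_normalizer g.2) 3 ?_ x ?_).trans
        (le_of_eq (by congr!))
      · intro d hd hd1
        obtain ⟨j, hj⟩ := IsPGroup.iff_orderOf.1 P.2 g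
        rw [Subgroup.orderOf_coe, hj] at hd
        exact aux_pow3 hd hd1
      · intro he
        apply hgx
        ext
        push_cast
        exact mul_inv_eq_iff_eq_mul.1 he)
    rw [← Nat.card_eq_fintype_card] at this
    have hz : (Z : Set (P : Subgroup G)).ncard = Nat.card Z := rfl
    rw [hz] at this
    nlinarith
end
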